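/- (Lozinskii.) The Fourier projection F_n is a minimal projection with respect to the operator norm: ‖F_n‖ ≤ ‖P‖ for every bounded linear projection P of C(2π) onto π_n. -/

import Mathlib

open Real MeasureTheory intervalIntegral

noncomputable section

instance : Fact ((0:ℝ) < 2 * π) := ⟨by positivity⟩

/-- The circle `ℝ / 2πℤ`; continuous functions on it are exactly the continuous
`2π`-periodic real-valued functions on `ℝ`, and `C(Circ2π, ℝ)` carries the supremum norm. -/
abbrev Circ2pi : Type := AddCircle (2 * π)

theorem cos_periodic' (k : ℕ) : Function.Periodic (fun t : ℝ => cos (k * t)) (2 * π) := by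
  intro t
  show cos (k * (t + 2 * π)) = cos (k * t)
  have h : (k : ℝ) * (t + 2 * π) = k * t + (k : ℤ) * (2 * π) := by push_cast; ring
  rw [h, Real.cos_add_int_mul_two_pi]

theorem sin_periodic' (k : ℕ) : Function.Periodic (fun t : ℝ => sin (k * t)) (2 * π) := by
  intro t
  show sin (k * (t + 2 * π)) = sin (k * t)
  have h : (k : ℝ) * (t + 2 * π) = k * t + (k : ℤ) * (2 * π) := by push_cast; ring
  rw [h, Real.sin_add_int_mul_two_pi]

/-- `t ↦ cos (k t)` as an element of `C(2π)`. -/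
def cosP (k : ℕ) : C(Circ2pi, ℝ) :=
  ⟨(cos_periodic' k).lift,
   continuous_coinduced_dom.mpr (by fun_prop : Continuous fun t : ℝ => cos (k * t))⟩

/-- `t ↦ sin (k t)` as an element of `C(2π)`. -/
def sinP (k : ℕ) : C(Circ2pi, ℝ) :=
  ⟨(sin_periodic' k).lift,
   continuous_coinduced_dom.mpr (by fun_prop : Continuous fun t : ℝ => sin (k * t))⟩

theorem cosP_apply (k : ℕ) (t : ℝ) : cosP k (t : Circ2pi) = cos (k * t) :=
  (cos_periodic' k).lift_coe t

theorem sinP_apply (k : ℕ) (t : ℝ) : sinP k (t : Circ2pi) = sin (k * t) :=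
  (sin_periodic' k).lift_coe t

/-- `π_n`: the subspace of trigonometric polynomials of degree at most `n`, spanned by
`1 = cos (0 ⬝ t)`, `cos (k t)` and `sin (k t)` for `1 ≤ k ≤ n`. -/
def trigPoly (n : ℕ) : Submodule ℝ C(Circ2pi, ℝ) :=
  Submodule.span ℝ
    ((Set.range fun k : Fin (n + 1) => cosP k) ∪ (Set.range fun k : Fin n => sinP (k + 1)))

/-- Translation `(T_g f)(t) = f (t + g)` on `C(2π)`. -/
def translateC (g : ℝ) (f : C(Circ2pi, ℝ)) : C(Circ2pi, ℝ) :=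
  f.comp ⟨fun θ => θ + (g : Circ2pi), by continuity⟩

/-- `F` is the `n`-th Fourier projection `F_n`: for every `f ∈ C(2π)` and `t ∈ ℝ`,
`(F f)(t) = a₀/2 + ∑_{k=1}^n (a_k cos (k t) + b_k sin (k t))`, where
`a_k = (1/π) ∫_0^{2π} f(s) cos (k s) ds` and `b_k = (1/π) ∫_0^{2π} f(s) sin (k s) ds`. -/
def IsFourierProjection (n : ℕ) (F : C(Circ2pi, ℝ) →L[ℝ] C(Circ2pi, ℝ)) : Prop :=
  ∀ (f : C(Circ2pi, ℝ)) (t : ℝ),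
    F f (t : Circ2pi) =
      1 / (2 * π) * (∫ s in (0:ℝ)..(2 * π), f (s : Circ2pi)) +
      ∑ k ∈ Finset.Icc 1 n,
        ((1 / π * ∫ s in (0:ℝ)..(2 * π), f (s : Circ2pi) * cos (k * s)) * cos (k * t) +
         (1 / π * ∫ s in (0:ℝ)..(2 * π), f (s : Circ2pi) * sin (k * s)) * sin (k * t))

theorem integral_cos_int_mul (m : ℤ) :
    ∫ s in (0:ℝ)..(2 * π), cos (m * s) = if m = 0 then 2 * π else 0 := by
  split_ifs with h
  · simp [h]
  · have hm : (m : ℝ) ≠ 0 := by exact_mod_cast h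
    rw [intervalIntegral.integral_comp_mul_left (fun x => cos x) hm, integral_cos]
    have : sin (m * (2 * π)) = 0 := by
      have := Real.sin_int_mul_pi (m * 2)
      push_cast at this
      rwa [mul_assoc] at this
    simp [this]

theorem integral_sin_int_mul (m : ℤ) : ∫ s in (0:ℝ)..(2 * π), sin (m * s) = 0 := by
  rcases eq_or_ne m 0 with h | h
  · simp [h]
  · have hm : (m : ℝ) ≠ 0 := by exact_mod_cast h
    rw [intervalIntegral.integral_comp_mul_left (fun x => sin x) hm, integral_sin,
      Real.cos_int_mul_two_pi]
    simp

theorem integral_cos_mul_cos (j k : ℕ) (hk : 1 ≤ k) :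
    ∫ s in (0:ℝ)..(2 * π), cos (j * s) * cos (k * s) = if j = k then π else 0 := by
  have h : ∀ s : ℝ, cos (j * s) * cos (k * s) =
      1 / 2 * (cos (((j - k : ℤ) : ℝ) * s) + cos (((j + k : ℤ) : ℝ) * s)) := by
    intro s
    push_cast
    rw [sub_mul, add_mul, cos_sub, cos_add]
    ring
  simp_rw [h]
  rw [intervalIntegral.integral_const_mul, intervalIntegral.integral_add
    (Continuous.intervalIntegrable (by fun_prop) _ _)
    (Continuous.intervalIntegrable (by fun_prop) _ _),
    integral_cos_int_mul, integral_cos_int_mul, if_neg (show ¬ ((j : ℤ) + k = 0) by omega)]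
  by_cases hjk : j = k
  · simp [hjk]
  · rw [if_neg (by omega), if_neg hjk]
    simp

theorem integral_sin_mul_sin (j k : ℕ) (hk : 1 ≤ k) :
    ∫ s in (0:ℝ)..(2 * π), sin (j * s) * sin (k * s) = if j = k then π else 0 := by
  have h : ∀ s : ℝ, sin (j * s) * sin (k * s) =
      1 / 2 * (cos (((j - k : ℤ) : ℝ) * s) - cos (((j + k : ℤ) : ℝ) * s)) := by
    intro s
    push_cast
    rw [sub_mul, add_mul, cos_sub, cos_add]
    ring
  simp_rw [h]
  rw [intervalIntegral.integral_const_mul, intervalIntegral.integral_sub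
    (Continuous.intervalIntegrable (by fun_prop) _ _)
    (Continuous.intervalIntegrable (by fun_prop) _ _),
    integral_cos_int_mul, integral_cos_int_mul, if_neg (show ¬ ((j : ℤ) + k = 0) by omega)]
  by_cases hjk : j = k
  · simp [hjk]
  · rw [if_neg (by omega), if_neg hjk]
    simp

theorem integral_sin_mul_cos (j k : ℕ) :
    ∫ s in (0:ℝ)..(2 * π), sin (j * s) * cos (k * s) = 0 := by
  have h : ∀ s : ℝ, sin (j * s) * cos (k * s) =
      1 / 2 * (sin (((j - k : ℤ) : ℝ) * s) + sin (((j + k : ℤ) : ℝ) * s)) := by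
    intro s
    push_cast
    rw [sub_mul, add_mul, sin_sub, sin_add]
    ring
  simp_rw [h]
  rw [intervalIntegral.integral_const_mul, intervalIntegral.integral_add
    (Continuous.intervalIntegrable (by fun_prop) _ _)
    (Continuous.intervalIntegrable (by fun_prop) _ _),
    integral_sin_int_mul, integral_sin_int_mul]
  simp

theorem integral_cos_mul_sin (j k : ℕ) :
    ∫ s in (0:ℝ)..(2 * π), cos (j * s) * sin (k * s) = 0 := by
  simp_rw [mul_comm (cos _)]
  exact integral_sin_mul_cos k j

theorem IsFourierProjection.apply_cosP {n : ℕ} {F : C(Circ2pi, ℝ) →L[ℝ] C(Circ2pi, ℝ)}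
    (hF : IsFourierProjection n F) (k : ℕ) (t : ℝ) :
    F (cosP k) (t : Circ2pi) = if k ≤ n then cos (k * t) else 0 := by
  rw [hF]
  simp only [cosP_apply, integral_cos_mul_sin]
  rw [Finset.sum_congr rfl (g := fun j => if k = j then cos (k * t) else 0)]
  · have h0 := integral_cos_int_mul k
    simp only [Int.cast_natCast] at h0
    rw [h0, Finset.sum_ite_eq]
    rcases Nat.eq_zero_or_pos k with rfl | hk
    · simp
      field_simp
    · simp [hk.ne', Nat.one_le_iff_ne_zero]
  · intro j hj
    rw [integral_cos_mul_cos k j (Finset.mem_Icc.mp hj).1]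
    split_ifs with h
    · simp [h, pi_ne_zero]
    · simp

theorem IsFourierProjection.apply_sinP {n : ℕ} {F : C(Circ2pi, ℝ) →L[ℝ] C(Circ2pi, ℝ)}
    (hF : IsFourierProjection n F) (k : ℕ) (t : ℝ) :
    F (sinP k) (t : Circ2pi) = if k ≤ n then sin (k * t) else 0 := by
  rw [hF]
  simp only [sinP_apply, integral_sin_mul_cos]
  rw [Finset.sum_congr rfl (g := fun j => if k = j then sin (k * t) else 0)]
  · have h0 := integral_sin_int_mul k
    simp only [Int.cast_natCast] at h0
    rw [h0, Finset.sum_ite_eq]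
    rcases Nat.eq_zero_or_pos k with rfl | hk
    · simp
    · simp [hk.ne', Nat.one_le_iff_ne_zero]
  · intro j hj
    rw [integral_sin_mul_sin k j (Finset.mem_Icc.mp hj).1]
    split_ifs with h
    · simp [h, pi_ne_zero]
    · simp

theorem cosP_mem_trigPoly {k n : ℕ} (h : k ≤ n) : cosP k ∈ trigPoly n :=
  Submodule.subset_span (Or.inl ⟨⟨k, Nat.lt_succ_of_le h⟩, rfl⟩)

theorem sinP_zero : sinP 0 = 0 := by
  ext x
  induction x using QuotientAddGroup.induction_on with
  | H t => exact (sinP_apply 0 t).trans (by simp)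

theorem sinP_mem_trigPoly {k n : ℕ} (h : k ≤ n) : sinP k ∈ trigPoly n := by
  rcases k with _ | k
  · rw [sinP_zero]
    exact Submodule.zero_mem _
  · exact Submodule.subset_span (Or.inr ⟨⟨k, h⟩, rfl⟩)

theorem translateC_apply (g : ℝ) (f : C(Circ2pi, ℝ)) (x : Circ2pi) :
    translateC g f x = f (x + (g : Circ2pi)) := rfl

theorem translateC_cosP (g : ℝ) (k : ℕ) :
    translateC g (cosP k) = cos (k * g) • cosP k - sin (k * g) • sinP k := by
  ext x
  induction x using QuotientAddGroup.induction_on with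
  | H t =>
    change cosP k ((t + g : ℝ) : Circ2pi) =
      cos (k * g) * cosP k (t : Circ2pi) - sin (k * g) * sinP k (t : Circ2pi)
    rw [cosP_apply, cosP_apply, sinP_apply, mul_add, cos_add]
    ring

theorem translateC_sinP (g : ℝ) (k : ℕ) :
    translateC g (sinP k) = cos (k * g) • sinP k + sin (k * g) • cosP k := by
  ext x
  induction x using QuotientAddGroup.induction_on with
  | H t =>
    change sinP k ((t + g : ℝ) : Circ2pi) =
      cos (k * g) * sinP k (t : Circ2pi) + sin (k * g) * cosP k (t : Circ2pi)
    rw [sinP_apply, cosP_apply, sinP_apply, mul_add, sin_add]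
    ring

theorem continuous_translateC (f : C(Circ2pi, ℝ)) : Continuous fun g => translateC g f :=
  (ContinuousMap.curry
    ⟨fun p : ℝ × Circ2pi => f (p.2 + (p.1 : Circ2pi)),
      f.continuous.comp
        (continuous_snd.add ((AddCircle.continuous_mk' (2 * π)).comp continuous_fst))⟩).continuous

theorem norm_translateC_le (g : ℝ) (f : C(Circ2pi, ℝ)) : ‖translateC g f‖ ≤ ‖f‖ :=
  (ContinuousMap.norm_le _ (norm_nonneg f)).2 fun _ => f.norm_coe_le_norm _

theorem continuous_apply_coe_sub (u : C(Circ2pi, ℝ)) (t : ℝ) :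
    Continuous fun g : ℝ => u ((t - g : ℝ) : Circ2pi) :=
  u.continuous.comp ((AddCircle.continuous_mk' (2 * π)).comp (by fun_prop))

theorem integral_mul_trigPoly_eq_zero {n k : ℕ} (hk : n < k) {u : C(Circ2pi, ℝ)}
    (hu : u ∈ trigPoly n) (t : ℝ) :
    ∫ g in (0:ℝ)..(2 * π), u ((t - g : ℝ) : Circ2pi) * cos (k * g) = 0 ∧
    ∫ g in (0:ℝ)..(2 * π), u ((t - g : ℝ) : Circ2pi) * sin (k * g) = 0 := by
  have hcc : ∀ j ≤ n, ∫ g in (0:ℝ)..(2 * π), cos (j * g) * cos (k * g) = 0 := fun j hj => by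
    rw [integral_cos_mul_cos j k (by omega), if_neg (by omega)]
  have hss : ∀ j ≤ n, ∫ g in (0:ℝ)..(2 * π), sin (j * g) * sin (k * g) = 0 := fun j hj => by
    rw [integral_sin_mul_sin j k (by omega), if_neg (by omega)]
  have split : ∀ (j : ℕ) (a b : ℝ) (w : ℝ → ℝ), Continuous w →
      ∫ g in (0:ℝ)..(2 * π), (a * cos (j * g) + b * sin (j * g)) * w g =
        a * (∫ g in (0:ℝ)..(2 * π), cos (j * g) * w g) +
        b * ∫ g in (0:ℝ)..(2 * π), sin (j * g) * w g := by
    intro j a b w hw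
    simp_rw [add_mul, mul_assoc]
    rw [intervalIntegral.integral_add
      (Continuous.intervalIntegrable (by fun_prop) _ _)
      (Continuous.intervalIntegrable (by fun_prop) _ _),
      intervalIntegral.integral_const_mul, intervalIntegral.integral_const_mul]
  have gen : ∀ j ≤ n, ∀ a b : ℝ,
      ∫ g in (0:ℝ)..(2 * π), (a * cos (j * g) + b * sin (j * g)) * cos (k * g) = 0 ∧
      ∫ g in (0:ℝ)..(2 * π), (a * cos (j * g) + b * sin (j * g)) * sin (k * g) = 0 := by
    intro j hj a b
    constructor
    · rw [split j a b (fun g => cos (k * g)) (by fun_prop), hcc j hj, integral_sin_mul_cos]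
      simp
    · rw [split j a b (fun g => sin (k * g)) (by fun_prop), hss j hj, integral_cos_mul_sin]
      simp
  have hcos : ∀ (j : ℕ) (g : ℝ), cosP j ((t - g : ℝ) : Circ2pi) =
      cos (j * t) * cos (j * g) + sin (j * t) * sin (j * g) := fun j g => by
    rw [cosP_apply, mul_sub, cos_sub]
  have hsin : ∀ (j : ℕ) (g : ℝ), sinP j ((t - g : ℝ) : Circ2pi) =
      sin (j * t) * cos (j * g) + (-cos (j * t)) * sin (j * g) := fun j g => by
    rw [sinP_apply, mul_sub, sin_sub]
    ring
  induction hu using Submodule.span_induction with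
  | mem u hu =>
    rcases hu with ⟨j, rfl⟩ | ⟨j, rfl⟩
    · simp only [hcos]
      exact gen j (by omega) _ _
    · simp only [hsin]
      exact gen (j + 1) (by omega) _ _
  | zero => simp
  | add u v _ _ hu hv =>
    have hu' := continuous_apply_coe_sub u t
    have hv' := continuous_apply_coe_sub v t
    simp only [ContinuousMap.add_apply, add_mul]
    rw [intervalIntegral.integral_add
      (Continuous.intervalIntegrable (by fun_prop) _ _)
      (Continuous.intervalIntegrable (by fun_prop) _ _), intervalIntegral.integral_add
      (Continuous.intervalIntegrable (by fun_prop) _ _)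
      (Continuous.intervalIntegrable (by fun_prop) _ _), hu.1, hu.2, hv.1, hv.2]
    simp
  | smul c u _ hu =>
    simp only [ContinuousMap.smul_apply, smul_eq_mul, mul_assoc]
    rw [intervalIntegral.integral_const_mul, intervalIntegral.integral_const_mul, hu.1, hu.2]
    simp

/-- The trigonometric polynomials of arbitrary degree. -/
def allTrigPoly : Submodule ℝ C(Circ2pi, ℝ) :=
  Submodule.span ℝ (Set.range cosP ∪ Set.range sinP)

theorem fourier_coe_eq_exp (m : ℤ) (t : ℝ) :
    fourier m (t : Circ2pi) = Complex.exp (((m * t : ℝ) : ℂ) * Complex.I) := by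
  rw [fourier_coe_apply]
  congr 1
  have : (π : ℂ) ≠ 0 := by exact_mod_cast pi_ne_zero
  push_cast
  field_simp

theorem re_comp_fourier (m : ℤ) :
    Complex.reCLM.compLeftContinuous ℝ Circ2pi (fourier m) = cosP m.natAbs := by
  ext x
  induction x using QuotientAddGroup.induction_on with
  | H t =>
    change (fourier m (t : Circ2pi)).re = cosP m.natAbs (t : Circ2pi)
    rw [fourier_coe_eq_exp, Complex.exp_ofReal_mul_I_re, cosP_apply]
    rcases Int.natAbs_eq m with h | h <;> rw [h] <;> simp

theorem im_comp_fourier_mem (m : ℤ) :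
    Complex.imCLM.compLeftContinuous ℝ Circ2pi (fourier m) ∈ allTrigPoly := by
  have hs : sinP m.natAbs ∈ allTrigPoly := Submodule.subset_span (Or.inr ⟨_, rfl⟩)
  have key : ∀ t : ℝ, Complex.imCLM.compLeftContinuous ℝ Circ2pi (fourier m) (t : Circ2pi) =
      sin (m * t) := fun t => by
    change (fourier m (t : Circ2pi)).im = _
    rw [fourier_coe_eq_exp, Complex.exp_ofReal_mul_I_im]
  rcases Int.natAbs_eq m with h | h
  · convert! hs using 1
    ext x
    induction x using QuotientAddGroup.induction_on with
    | H t =>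
      refine (key t).trans ((sinP_apply _ t).trans ?_).symm
      conv_rhs => rw [h]
      simp
  · convert! Submodule.neg_mem _ hs using 1
    ext x
    induction x using QuotientAddGroup.induction_on with
    | H t =>
      refine (key t).trans ((congrArg Neg.neg (sinP_apply _ t)).trans ?_).symm
      conv_rhs => rw [h]
      simp

theorem re_im_comp_mem_allTrigPoly {p : C(Circ2pi, ℂ)}
    (hp : p ∈ Submodule.span ℂ (Set.range (@fourier (2 * π)))) :
    Complex.reCLM.compLeftContinuous ℝ Circ2pi p ∈ allTrigPoly ∧
    Complex.imCLM.compLeftContinuous ℝ Circ2pi p ∈ allTrigPoly := by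
  induction hp using Submodule.span_induction with
  | mem p hp =>
    obtain ⟨m, rfl⟩ := hp
    refine ⟨?_, im_comp_fourier_mem m⟩
    rw [re_comp_fourier]
    exact Submodule.subset_span (Or.inl ⟨_, rfl⟩)
  | zero => simp
  | add p q _ _ hp hq =>
    rw [map_add, map_add]
    exact ⟨Submodule.add_mem _ hp.1 hq.1, Submodule.add_mem _ hp.2 hq.2⟩
  | smul c p _ hp =>
    constructor
    · convert! Submodule.sub_mem _ (Submodule.smul_mem _ c.re hp.1)
        (Submodule.smul_mem _ c.im hp.2) using 1
    · convert! Submodule.add_mem _ (Submodule.smul_mem _ c.re hp.2)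
        (Submodule.smul_mem _ c.im hp.1) using 1

theorem mem_closure_allTrigPoly (f : C(Circ2pi, ℝ)) :
    f ∈ closure (allTrigPoly : Set C(Circ2pi, ℝ)) := by
  have h : Complex.ofRealCLM.compLeftContinuous ℝ Circ2pi f ∈
      (Submodule.span ℂ (Set.range (@fourier (2 * π)))).topologicalClosure := by
    rw [span_fourier_closure_eq_top]
    trivial
  exact map_mem_closure (Complex.reCLM.compLeftContinuous ℝ Circ2pi).continuous h
    fun p hp => (re_im_comp_mem_allTrigPoly hp).1

theorem continuous_apply_translateC (P : C(Circ2pi, ℝ) →L[ℝ] C(Circ2pi, ℝ))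
    (f : C(Circ2pi, ℝ)) (t : ℝ) :
    Continuous fun g : ℝ => P (translateC g f) ((t - g : ℝ) : Circ2pi) :=
  (P.continuous.comp (continuous_translateC f)).eval
    ((AddCircle.continuous_mk' (2 * π)).comp (by fun_prop))

/-- Marcinkiewicz's identity: averaging the conjugates of a projection onto `π_n` by translations
gives the Fourier projection, at least on trigonometric polynomials. -/
theorem IsFourierProjection.integral_conj_translateC {n : ℕ}
    {F P : C(Circ2pi, ℝ) →L[ℝ] C(Circ2pi, ℝ)} (hF : IsFourierProjection n F)
    (hP : ∀ f, P f ∈ trigPoly n) (hPid : ∀ v ∈ trigPoly n, P v = v)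
    {f : C(Circ2pi, ℝ)} (hf : f ∈ allTrigPoly) (t : ℝ) :
    ∫ g in (0:ℝ)..(2 * π), P (translateC g f) ((t - g : ℝ) : Circ2pi) =
      2 * π * F f (t : Circ2pi) := by
  have hback : ∀ (f : C(Circ2pi, ℝ)) (g : ℝ),
      translateC g f ((t - g : ℝ) : Circ2pi) = f (t : Circ2pi) := fun f g => by
    rw [translateC_apply, ← AddCircle.coe_add, sub_add_cancel]
  induction hf using Submodule.span_induction with
  | mem f hf =>
    rcases hf with ⟨k, rfl⟩ | ⟨k, rfl⟩
    · rw [hF.apply_cosP]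
      split_ifs with hk
      · have hmem : ∀ g, translateC g (cosP k) ∈ trigPoly n := fun g => by
          rw [translateC_cosP]
          exact Submodule.sub_mem _ (Submodule.smul_mem _ _ (cosP_mem_trigPoly hk))
            (Submodule.smul_mem _ _ (sinP_mem_trigPoly hk))
        simp only [hPid _ (hmem _), hback, cosP_apply]
        simp
      · have hc := continuous_apply_coe_sub (P (cosP k)) t
        have hs := continuous_apply_coe_sub (P (sinP k)) t
        simp only [translateC_cosP, map_sub, map_smul, ContinuousMap.sub_apply,
          ContinuousMap.smul_apply, smul_eq_mul, mul_comm (cos _), mul_comm (sin _)]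
        rw [intervalIntegral.integral_sub
          (Continuous.intervalIntegrable (by fun_prop) _ _)
          (Continuous.intervalIntegrable (by fun_prop) _ _),
          (integral_mul_trigPoly_eq_zero (not_le.mp hk) (hP _) t).1,
          (integral_mul_trigPoly_eq_zero (not_le.mp hk) (hP _) t).2]
        simp
    · rw [hF.apply_sinP]
      split_ifs with hk
      · have hmem : ∀ g, translateC g (sinP k) ∈ trigPoly n := fun g => by
          rw [translateC_sinP]
          exact Submodule.add_mem _ (Submodule.smul_mem _ _ (sinP_mem_trigPoly hk))
            (Submodule.smul_mem _ _ (cosP_mem_trigPoly hk))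
        simp only [hPid _ (hmem _), hback, sinP_apply]
        simp
      · have hc := continuous_apply_coe_sub (P (cosP k)) t
        have hs := continuous_apply_coe_sub (P (sinP k)) t
        simp only [translateC_sinP, map_add, map_smul, ContinuousMap.add_apply,
          ContinuousMap.smul_apply, smul_eq_mul, mul_comm (cos _), mul_comm (sin _)]
        rw [intervalIntegral.integral_add
          (Continuous.intervalIntegrable (by fun_prop) _ _)
          (Continuous.intervalIntegrable (by fun_prop) _ _),
          (integral_mul_trigPoly_eq_zero (not_le.mp hk) (hP _) t).1,
          (integral_mul_trigPoly_eq_zero (not_le.mp hk) (hP _) t).2]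
        simp
  | zero =>
    have h0 : ∀ g, translateC g 0 = 0 := fun g => rfl
    simp [h0]
  | add f₁ f₂ _ _ h₁ h₂ =>
    have hadd : ∀ g, translateC g (f₁ + f₂) = translateC g f₁ + translateC g f₂ := fun g => rfl
    simp only [hadd, map_add, ContinuousMap.add_apply]
    rw [intervalIntegral.integral_add
      ((continuous_apply_translateC P f₁ t).intervalIntegrable _ _)
      ((continuous_apply_translateC P f₂ t).intervalIntegrable _ _), h₁, h₂, mul_add]
  | smul c f _ h =>
    have hsmul : ∀ g, translateC g (c • f) = c • translateC g f := fun g => rfl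
    simp only [hsmul, map_smul, ContinuousMap.smul_apply, smul_eq_mul]
    rw [intervalIntegral.integral_const_mul, h]
    ring

theorem IsFourierProjection.norm_apply_le {n : ℕ}
    {F P : C(Circ2pi, ℝ) →L[ℝ] C(Circ2pi, ℝ)} (hF : IsFourierProjection n F)
    (hP : ∀ f, P f ∈ trigPoly n) (hPid : ∀ v ∈ trigPoly n, P v = v)
    {f : C(Circ2pi, ℝ)} (hf : f ∈ allTrigPoly) : ‖F f‖ ≤ ‖P‖ * ‖f‖ := by
  refine (ContinuousMap.norm_le _ (by positivity)).2 fun x => ?_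
  induction x using QuotientAddGroup.induction_on with
  | H t =>
    have hbound := intervalIntegral.norm_integral_le_of_norm_le_const (a := 0) (b := 2 * π)
      (C := ‖P‖ * ‖f‖) (f := fun g : ℝ => P (translateC g f) ((t - g : ℝ) : Circ2pi))
      fun g _ => ((P (translateC g f)).norm_coe_le_norm _).trans
        ((P.le_opNorm _).trans
          (mul_le_mul_of_nonneg_left (norm_translateC_le g f) (norm_nonneg P)))
    rw [hF.integral_conj_translateC hP hPid hf t, norm_mul, sub_zero, Real.norm_eq_abs (2 * π),
      abs_of_pos two_pi_pos, mul_comm] at hbound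
    exact le_of_mul_le_mul_right hbound two_pi_pos

/-- **Lozinskii's theorem.** The Fourier projection `F_n` is a minimal projection of `C(2π)`
onto `π_n` with respect to the operator norm: `‖F_n‖ ≤ ‖P‖` for every bounded linear
projection `P` of `C(2π)` onto `π_n`. -/
theorem fourierProjection_norm_minimal (n : ℕ) (hn : 1 ≤ n)
    (F : C(Circ2pi, ℝ) →L[ℝ] C(Circ2pi, ℝ)) (hF : IsFourierProjection n F) :
    ∀ P : C(Circ2pi, ℝ) →L[ℝ] C(Circ2pi, ℝ),
      (∀ f : C(Circ2pi, ℝ), P f ∈ trigPoly n) → (∀ v ∈ trigPoly n, P v = v) →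
      ‖F‖ ≤ ‖P‖ := by
  intro P hP hPid
  refine F.opNorm_le_bound (norm_nonneg P) fun f => ?_
  exact closure_minimal (fun p hp => hF.norm_apply_le hP hPid hp)
    (isClosed_le (by fun_prop) (by fun_prop) : IsClosed {f | ‖F f‖ ≤ ‖P‖ * ‖f‖})
    (mem_closure_allTrigPoly f)
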